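/- Let a₁ > a₂ > 0 and λ > 0. Let Γ = {(x,y) ∈ ℝ² : x²/(a₁² + λ) + y²/(a₂² + λ) = 1} and γ = {(x,y) ∈ ℝ² : x²/a₁² + y²/a₂² = 1}, a pair of confocal ellipses with γ inside Γ. Call a sequence of points x : ℕ → ℝ² an admissible billiard trajectory if for every i: xᵢ ∈ Γ, x_{i+1} ≠ xᵢ, x_{i+2} ≠ xᵢ, and the line through xᵢ and x_{i+1} meets γ in exactly one point (i.e., each chord is tangent to γ). Let n ≥ 3. If there exists an admissible trajectory x with x_n = x_0 and x_{n+1} = x_1, then every admissible trajectory y satisfies y_n = y_0. (Poncelet closure theorem for confocal ellipses.) -/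

import Mathlib

open Real

/-- A line through two distinct points meeting the ellipse `x² / U + y² / V = 1` in exactly one
point satisfies the vanishing-discriminant condition. -/
lemma discrim_eq_of_existsUnique_inter {U V : ℝ} (hU : 0 < U) (hV : 0 < V) {p q : ℝ × ℝ}
    (hpq : q ≠ p)
    (h : ∃! z : ℝ × ℝ, (∃ t : ℝ, z = p + t • (q - p)) ∧ z.1 ^ 2 / U + z.2 ^ 2 / V = 1) :
    U * (q.2 - p.2) ^ 2 + V * (q.1 - p.1) ^ 2 = (p.1 * q.2 - q.1 * p.2) ^ 2 := by
  obtain ⟨z, ⟨⟨t, rfl⟩, hz⟩, huniq⟩ := h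
  obtain ⟨x₁, y₁⟩ := p
  obtain ⟨x₂, y₂⟩ := q
  simp only [Prod.mk_sub_mk, Prod.smul_mk, Prod.mk_add_mk, smul_eq_mul] at hz huniq ⊢
  obtain ⟨m, hm⟩ : ∃ m, m = x₂ - x₁ := ⟨_, rfl⟩
  obtain ⟨k, hk⟩ : ∃ k, k = y₂ - y₁ := ⟨_, rfl⟩
  obtain rfl : x₂ = x₁ + m := by linarith
  obtain rfl : y₂ = y₁ + k := by linarith
  rw [← hm, ← hk] at hz huniq ⊢
  have hmk : m ≠ 0 ∨ k ≠ 0 := by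
    by_contra! hc
    exact hpq (by simp [hc.1, hc.2])
  have ha : 0 < V * m ^ 2 + U * k ^ 2 := by
    rcases hmk with h | h <;> positivity
  field_simp at hz
  obtain ⟨t', ht'⟩ : ∃ t' : ℝ,
      (V * m ^ 2 + U * k ^ 2) * (t' + t) = -2 * (V * x₁ * m + U * y₁ * k) :=
    ⟨-2 * (V * x₁ * m + U * y₁ * k) / (V * m ^ 2 + U * k ^ 2) - t, by field_simp; ring⟩
  have heq := huniq (x₁ + t' * m, y₁ + t' * k) ⟨⟨t', rfl⟩, by
    field_simp
    linear_combination hz + (t' - t) * ht'⟩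
  have htt : t' = t := by
    simp only [Prod.mk.injEq, add_right_inj, mul_eq_mul_right_iff] at heq
    tauto
  subst htt
  have hb : (V * m ^ 2 + U * k ^ 2) * t' = -(V * x₁ * m + U * y₁ * k) := by linarith
  apply mul_left_cancel₀ (mul_pos hU hV).ne'
  linear_combination (-(V * m ^ 2 + U * k ^ 2)) * hz
    + ((V * m ^ 2 + U * k ^ 2) * t' + (V * x₁ * m + U * y₁ * k)) * hb

/-- The invariant measure of the Poncelet map: in a suitable monotone coordinate `F` on the
universal cover of the unit circle, the passage between the endpoints `s - d`, `s + d` of a chord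
tangent to the ellipse `x² / u + y² / v = 1` is a translation. -/
lemma exists_poncelet_coordinate {u v : ℝ} (hu : 0 < u) (hu1 : u < 1) (hv : 0 < v) (hv1 : v < 1) :
    ∃ (F : ℝ → ℝ) (P c : ℝ), StrictMono F ∧ (∀ θ, F (θ + 2 * π) = F θ + P) ∧
      ∀ s d : ℝ, 0 < d → d < π / 2 → cos d ^ 2 = u * cos s ^ 2 + v * sin s ^ 2 →
        F (s + d) - F (s - d) = c := by
  obtain ⟨Q, hQ⟩ : ∃ Q : ℝ → ℝ, ∀ θ, Q θ = cos θ ^ 2 / u + sin θ ^ 2 / v - 1 := ⟨_, fun _ => rfl⟩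
  have hQpos : ∀ θ, 0 < Q θ := by
    intro θ
    have h1 : cos θ ^ 2 / u + sin θ ^ 2 / v - 1
        = (cos θ ^ 2 * (1 - u) * v + sin θ ^ 2 * (1 - v) * u) / (u * v) := by
      field_simp
      linear_combination (u * v) * sin_sq_add_cos_sq θ
    rw [hQ, h1]
    apply div_pos _ (by positivity)
    have h2 := sin_sq_add_cos_sq θ
    have hu' : 0 < (1 - u) * v := mul_pos (by linarith) hv
    have hv' : 0 < (1 - v) * u := mul_pos (by linarith) hu
    rcases eq_or_ne (cos θ) 0 with h | h
    · have : sin θ ^ 2 = 1 := by rw [h] at h2; linarith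
      rw [h, this]; nlinarith
    · have := mul_pos (pow_pos (abs_pos.2 h) 2) hu'
      rw [sq_abs] at this
      nlinarith [mul_nonneg (sq_nonneg (sin θ)) hv'.le]
  have hQcont : Continuous Q := by
    have : Q = fun θ => cos θ ^ 2 / u + sin θ ^ 2 / v - 1 := funext hQ
    rw [this]; fun_prop
  have hcont : Continuous fun θ => 1 / √(Q θ) :=
    continuous_const.div hQcont.sqrt fun θ => (sqrt_pos.2 (hQpos θ)).ne'
  obtain ⟨F, hF⟩ : ∃ F : ℝ → ℝ, ∀ θ, HasDerivAt F (1 / √(Q θ)) θ :=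
    ⟨fun θ => ∫ x in (0 : ℝ)..θ, 1 / √(Q x), fun θ => hcont.integral_hasStrictDerivAt 0 θ
      |>.hasDerivAt⟩
  have const_of : ∀ f : ℝ → ℝ, (∀ x, HasDerivAt f 0 x) → ∀ x, f x = f 0 := fun f hf x =>
    is_const_of_deriv_eq_zero (fun y => (hf y).differentiableAt) (fun y => (hf y).deriv) x 0
  obtain ⟨G, hG⟩ : ∃ G : ℝ → ℝ, ∀ s, G s = u * cos s ^ 2 + v * sin s ^ 2 := ⟨_, fun _ => rfl⟩
  have hG0 : ∀ s, 0 < G s := by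
    intro s; rw [hG]
    have := sin_sq_add_cos_sq s
    nlinarith [sq_nonneg (sin s), sq_nonneg (cos s), mul_nonneg hu.le (sq_nonneg (cos s)),
      mul_nonneg hv.le (sq_nonneg (sin s)), mul_pos hu hv]
  have hG1 : ∀ s, G s < 1 := by
    intro s; rw [hG]
    have := sin_sq_add_cos_sq s
    nlinarith [sq_nonneg (sin s), sq_nonneg (cos s), mul_nonneg (sub_pos.2 hu1).le (sq_nonneg (cos s)),
      mul_nonneg (sub_pos.2 hv1).le (sq_nonneg (sin s)), mul_pos (sub_pos.2 hu1) (sub_pos.2 hv1)]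
  have hGd : ∀ s, HasDerivAt G (-2 * (u - v) * sin s * cos s) s := by
    intro s
    have h := (((hasDerivAt_cos s).pow 2).const_mul u).add (((hasDerivAt_sin s).pow 2).const_mul v)
    have hfun : G = fun s => u * cos s ^ 2 + v * sin s ^ 2 := funext hG
    rw [hfun]
    refine h.congr_deriv ?_
    push_cast
    ring
  obtain ⟨D, hD⟩ : ∃ D : ℝ → ℝ, ∀ s, D s = arccos √(G s) := ⟨_, fun _ => rfl⟩
  have hsqrt1 : ∀ s, √(G s) < 1 := fun s => by
    rw [sqrt_lt' one_pos]; simpa using hG1 s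
  have hcosD : ∀ s, cos (D s) = √(G s) := fun s => by
    rw [hD, cos_arccos (by linarith [sqrt_nonneg (G s)]) (hsqrt1 s).le]
  have hsinD : ∀ s, sin (D s) = √(1 - G s) := fun s => by
    rw [hD, sin_arccos, sq_sqrt (hG0 s).le]
  have hDd : ∀ s, HasDerivAt D ((u - v) * sin s * cos s / (√(1 - G s) * √(G s))) s := by
    intro s
    have h1 := (hGd s).sqrt (hG0 s).ne'
    have h2 := (hasDerivAt_arccos (x := √(G s)) (by linarith [sqrt_nonneg (G s)])
      (hsqrt1 s).ne).comp s h1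
    have hfun : D = arccos ∘ fun s => √(G s) := funext hD
    rw [hfun]
    refine h2.congr_deriv ?_
    rw [sq_sqrt (hG0 s).le]
    have := (sqrt_pos.2 (hG0 s)).ne'
    have := (sqrt_pos.2 (sub_pos.2 (hG1 s))).ne'
    field_simp
  have key : ∀ s, HasDerivAt (fun s => F (s + D s) - F (s - D s)) 0 s := by
    intro s
    have hplus := (hF (s + D s)).comp s ((hasDerivAt_id s).add (hDd s))
    have hminus := (hF (s - D s)).comp s ((hasDerivAt_id s).sub (hDd s))
    refine (hplus.sub hminus).congr_deriv ?_
    have hCp := sqrt_pos.2 (hG0 s)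
    have hSp := sqrt_pos.2 (sub_pos.2 (hG1 s))
    have hC2 : √(G s) ^ 2 = u * cos s ^ 2 + v * sin s ^ 2 := by rw [sq_sqrt (hG0 s).le, hG]
    have hS2 : √(1 - G s) ^ 2 = 1 - (u * cos s ^ 2 + v * sin s ^ 2) := by
      rw [sq_sqrt (sub_pos.2 (hG1 s)).le, hG]
    have hQp : Q (s + D s)
        = (√(G s) * cos s - √(1 - G s) * sin s) ^ 2 / u
          + (√(G s) * sin s + √(1 - G s) * cos s) ^ 2 / v - 1 := by
      rw [hQ, cos_add, sin_add, hcosD, hsinD]; ring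
    have hQm : Q (s - D s)
        = (√(G s) * cos s + √(1 - G s) * sin s) ^ 2 / u
          + (√(G s) * sin s - √(1 - G s) * cos s) ^ 2 / v - 1 := by
      rw [hQ, cos_sub, sin_sub, hcosD, hsinD]; ring
    have hcs := sin_sq_add_cos_sq s
    rw [hQp, hQm]
    generalize √(G s) = C at *
    generalize √(1 - G s) = S at *
    generalize cos s = x at *
    generalize sin s = y at *
    obtain ⟨e, he⟩ : ∃ e, e = (u - v) * y * x / (S * C) := ⟨_, rfl⟩
    have heSC : e * (S * C) = (u - v) * y * x := by rw [he]; field_simp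
    rw [← he]
    have hlt : ((u - v) * y * x) ^ 2 < (S * C) ^ 2 := by
      have : (S * C) ^ 2 - ((u - v) * y * x) ^ 2 = u * (1 - u) * x ^ 2 + v * (1 - v) * y ^ 2 := by
        have hx : x ^ 2 = 1 - y ^ 2 := by linarith
        rw [mul_pow S C, hS2, hC2, mul_pow, hx]
        ring
      have hu' : 0 < u * (1 - u) := mul_pos hu (by linarith)
      have hv' : 0 < v * (1 - v) := mul_pos hv (by linarith)
      nlinarith [mul_nonneg hu'.le (sq_nonneg x), mul_nonneg hv'.le (sq_nonneg y), mul_pos hu' hv']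
    have he1 : |e| < 1 := by
      have := abs_lt_of_sq_lt_sq hlt (by positivity)
      rw [he, abs_div, abs_of_pos (mul_pos hSp hCp), div_lt_one (by positivity)]
      exact this
    have hel := (abs_lt.1 he1).1
    have heu := (abs_lt.1 he1).2
    have hK : 0 < y ^ 2 / u + x ^ 2 / v := by
      rcases eq_or_ne y 0 with h | h
      · have : x ^ 2 = 1 := by rw [h] at hcs; linarith
        rw [h, this]; simp [hv]
      · positivity
    have hquad : ∀ T, (C * x - T * y) ^ 2 / u + (C * y + T * x) ^ 2 / v - 1
        = (T * C + (u - v) * y * x) ^ 2 / (u * v) := by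
      intro T
      field_simp
      linear_combination (v * x ^ 2 + u * y ^ 2 - T ^ 2) * hC2
        + u * v * (x ^ 2 + y ^ 2 + 1) * hcs
    have hKC : y ^ 2 / u + x ^ 2 / v = C ^ 2 / (u * v) := by
      rw [hC2]; field_simp; ring
    have hp : (C * x - S * y) ^ 2 / u + (C * y + S * x) ^ 2 / v - 1
        = (S * (1 + e)) ^ 2 * (y ^ 2 / u + x ^ 2 / v) := by
      rw [hquad, hKC, ← heSC]; ring
    have hm : (C * x + S * y) ^ 2 / u + (C * y - S * x) ^ 2 / v - 1
        = (S * (1 - e)) ^ 2 * (y ^ 2 / u + x ^ 2 / v) := by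
      have := hquad (-S)
      rw [← heSC] at this
      rw [hKC]
      linear_combination this
    rw [hp, hm, sqrt_mul (sq_nonneg _), sqrt_mul (sq_nonneg _),
      sqrt_sq (mul_pos hSp (by linarith)).le, sqrt_sq (mul_pos hSp (by linarith)).le]
    have := (sqrt_pos.2 hK).ne'
    have h1 : (1 + e) ≠ 0 := by linarith
    have h2 : (1 - e) ≠ 0 := by linarith
    field_simp
    ring
  refine ⟨F, F (2 * π) - F 0, F (0 + D 0) - F (0 - D 0), ?_, ?_, ?_⟩
  · exact strictMono_of_deriv_pos fun θ => by
      rw [(hF θ).deriv]; exact one_div_pos.2 (sqrt_pos.2 (hQpos θ))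
  · intro θ
    have hper := const_of (fun θ => F (θ + 2 * π) - F θ) (fun θ => by
      have h1 := (hF (θ + 2 * π)).comp_add_const θ (2 * π)
      refine (h1.sub (hF θ)).congr_deriv ?_
      rw [hQ, hQ, cos_add_two_pi, sin_add_two_pi, sub_self]) θ
    simp only [zero_add] at hper
    linarith
  · intro s d hd0 hd1 hd
    have hdD : d = D s := by
      rw [hD, hG, ← hd, sqrt_sq (cos_pos_of_mem_Ioo ⟨by linarith, hd1⟩).le,
        arccos_cos hd0.le (by linarith)]
    rw [hdD]
    exact const_of _ key s

lemma exists_angle_of_mem_ellipse {A B : ℝ} (hA : 0 < A) (hB : 0 < B) {p : ℝ × ℝ}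
    (hp : p.1 ^ 2 / A ^ 2 + p.2 ^ 2 / B ^ 2 = 1) : ∃ θ, p = (A * cos θ, B * sin θ) := by
  obtain ⟨z, hz⟩ : ∃ z : ℂ, z = ⟨p.1 / A, p.2 / B⟩ := ⟨_, rfl⟩
  have hn : ‖z‖ = 1 := by
    rw [Complex.norm_def, sqrt_eq_one, Complex.normSq_apply, hz, ← hp]
    ring
  refine ⟨z.arg, ?_⟩
  have h1 := Complex.norm_mul_cos_arg z
  have h2 := Complex.norm_mul_sin_arg z
  rw [hn, one_mul, hz] at h1 h2
  simp only at h1 h2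
  rw [hz]
  ext
  · simp only [h1]; field_simp
  · simp only [h2]; field_simp

/-- A chord of the circle with half-angle parameters `s`, `d` satisfying the tangency condition
moves the coordinate `F` by `c`, in one of the two directions. -/
lemma exists_angle_of_tangent_chord {u v A B : ℝ} {F : ℝ → ℝ} {c : ℝ} (hu : 0 < u) (hv : 0 < v)
    (hA : 0 < A) (hB : 0 < B)
    (hF : ∀ s d : ℝ, 0 < d → d < π / 2 → cos d ^ 2 = u * cos s ^ 2 + v * sin s ^ 2 →
      F (s + d) - F (s - d) = c)
    (α : ℝ) {q : ℝ × ℝ} (hq : q.1 ^ 2 / A ^ 2 + q.2 ^ 2 / B ^ 2 = 1)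
    (hne : q ≠ (A * cos α, B * sin α))
    (htan : u * A ^ 2 * (q.2 - B * sin α) ^ 2 + v * B ^ 2 * (q.1 - A * cos α) ^ 2
      = (A * cos α * q.2 - q.1 * (B * sin α)) ^ 2) :
    ∃ β, q = (A * cos β, B * sin β) ∧ (F β = F α + c ∨ F β = F α - c) := by
  obtain ⟨β₀, hβ₀⟩ := exists_angle_of_mem_ellipse hA hB hq
  obtain ⟨β, ⟨hβ1, hβ2⟩, hβ⟩ : ∃ β, β ∈ Set.Ico α (α + 2 * π) ∧ q = (A * cos β, B * sin β) := by
    refine ⟨toIcoMod two_pi_pos α β₀, toIcoMod_mem_Ico _ _ _, ?_⟩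
    rw [← self_sub_toIcoDiv_zsmul, zsmul_eq_mul, cos_sub_int_mul_two_pi, sin_sub_int_mul_two_pi, hβ₀]
  have hαβ : α < β := lt_of_le_of_ne hβ1 fun h => hne (by rw [hβ, h])
  obtain ⟨s, hs⟩ : ∃ s, s = (α + β) / 2 := ⟨_, rfl⟩
  obtain ⟨d, hd⟩ : ∃ d, d = (β - α) / 2 := ⟨_, rfl⟩
  have hα' : α = s - d := by rw [hs, hd]; ring
  have hβ' : β = s + d := by rw [hs, hd]; ring
  have hd0 : 0 < d := by linarith
  have hdπ : d < π := by linarith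
  have hsd : 0 < sin d := sin_pos_of_pos_of_lt_pi hd0 hdπ
  have hcd : cos d ^ 2 = u * cos s ^ 2 + v * sin s ^ 2 := by
    have h1 := sin_sq_add_cos_sq s
    rw [hβ, hα', hβ'] at htan
    simp only [cos_add, sin_add, cos_sub, sin_sub] at htan
    have h2 : 4 * (A * B * sin d) ^ 2 ≠ 0 := by positivity
    apply mul_left_cancel₀ h2
    linear_combination -htan - 4 * (A * B * sin d * cos d) ^ 2 * (sin s ^ 2 + cos s ^ 2 + 1) * h1
  have hcd0 : 0 < cos d ^ 2 := by
    rw [hcd]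
    rcases eq_or_ne (sin s) 0 with h | h
    · have : cos s ^ 2 = 1 := by have := sin_sq_add_cos_sq s; rw [h] at this; linarith
      rw [h, this]; simpa using hu
    · positivity
  rcases lt_trichotomy d (π / 2) with h | h | h
  · exact ⟨β, hβ, Or.inl (by rw [hα', hβ', ← hF s d hd0 h hcd]; ring)⟩
  · rw [h, cos_pi_div_two] at hcd0
    simp at hcd0
  · refine ⟨β - 2 * π, by rw [hβ, cos_sub_two_pi, sin_sub_two_pi], Or.inr ?_⟩
    have := hF (s - π) (π - d) (by linarith) (by linarith) (by
      rw [cos_pi_sub, cos_sub_pi, sin_sub_pi, neg_sq, neg_sq, neg_sq, hcd])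
    rw [← this, hα', hβ']
    ring_nf

/-- Lifting a polygonal line whose sides are tangent to the inner ellipse to the coordinate `F`
gives an arithmetic progression. -/
lemma exists_angles_of_trajectory {u v A B : ℝ} {F : ℝ → ℝ} {c : ℝ} (hu : 0 < u) (hv : 0 < v)
    (hA : 0 < A) (hB : 0 < B) (hinj : Function.Injective F)
    (hF : ∀ s d : ℝ, 0 < d → d < π / 2 → cos d ^ 2 = u * cos s ^ 2 + v * sin s ^ 2 →
      F (s + d) - F (s - d) = c)
    {x : ℕ → ℝ × ℝ} (hx : ∀ i, (x i).1 ^ 2 / A ^ 2 + (x i).2 ^ 2 / B ^ 2 = 1)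
    (hne : ∀ i, x (i + 1) ≠ x i) (hne' : ∀ i, x (i + 2) ≠ x i)
    (htan : ∀ i, u * A ^ 2 * ((x (i + 1)).2 - (x i).2) ^ 2
      + v * B ^ 2 * ((x (i + 1)).1 - (x i).1) ^ 2
      = ((x i).1 * (x (i + 1)).2 - (x (i + 1)).1 * (x i).2) ^ 2) :
    ∃ (θ : ℕ → ℝ) (r : ℝ), (r = c ∨ r = -c) ∧ (∀ i, x i = (A * cos (θ i), B * sin (θ i))) ∧
      ∀ i : ℕ, F (θ i) = F (θ 0) + i * r := by
  have step : ∀ i α, x i = (A * cos α, B * sin α) →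
      ∃ β, x (i + 1) = (A * cos β, B * sin β) ∧ (F β = F α + c ∨ F β = F α - c) := by
    intro i α hα
    have h := htan i
    have hn := hne i
    rw [hα] at h hn
    exact exists_angle_of_tangent_chord hu hv hA hB hF α (hx (i + 1)) hn h
  choose! next hnext hFnext using step
  obtain ⟨θ₀, hθ₀⟩ := exists_angle_of_mem_ellipse hA hB (hx 0)
  obtain ⟨θ, hθ0, hθs⟩ : ∃ θ : ℕ → ℝ, θ 0 = θ₀ ∧ ∀ i, θ (i + 1) = next i (θ i) :=
    ⟨fun i => Nat.rec θ₀ next i, rfl, fun _ => rfl⟩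
  have hθ : ∀ i, x i = (A * cos (θ i), B * sin (θ i)) := by
    intro i
    induction i with
    | zero => rw [hθ0, hθ₀]
    | succ i ih => rw [hθs]; exact hnext i _ ih
  have hstep : ∀ i, F (θ (i + 1)) = F (θ i) + c ∨ F (θ (i + 1)) = F (θ i) - c := fun i => by
    rw [hθs]; exact hFnext i _ (hθ i)
  have hturn : ∀ i, F (θ (i + 2)) ≠ F (θ i) := fun i h =>
    hne' i (by rw [hθ, hθ i, hinj h])
  have hconst : ∀ i, F (θ (i + 1)) - F (θ i) = F (θ 1) - F (θ 0) := by
    intro i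
    induction i with
    | zero => rfl
    | succ i ih =>
      rw [← ih]
      have h := hturn i
      rcases hstep i with h1 | h1 <;> rcases hstep (i + 1) with h2 | h2
      · linarith
      · exact absurd (by rw [h2, h1]; ring) h
      · exact absurd (by rw [h2, h1]; ring) h
      · linarith
  refine ⟨θ, F (θ 1) - F (θ 0), ?_, hθ, ?_⟩
  · rcases hstep 0 with h | h
    · left; linarith
    · right; linarith
  · intro i
    induction i with
    | zero => simp
    | succ i ih =>
      push_cast
      linarith [hconst i]

/-- Corollary 6 (Poncelet closure theorem for confocal ellipses): if one
billiard trajectory in the outer ellipse `Γ`, all of whose chords are tangent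
to the inner confocal ellipse `γ`, closes up after `n` steps, then every such
trajectory closes up after `n` steps. -/
theorem poncelet_closure_confocal
    (a₁ a₂ lam : ℝ) (ha : a₂ < a₁) (ha₂ : 0 < a₂) (hlam : 0 < lam)
    (n : ℕ) (hn : 3 ≤ n)
    (Admissible : (ℕ → ℝ × ℝ) → Prop)
    (hAdm : ∀ x : ℕ → ℝ × ℝ, Admissible x ↔ ∀ i : ℕ,
      ((x i).1 ^ 2 / (a₁ ^ 2 + lam) + (x i).2 ^ 2 / (a₂ ^ 2 + lam) = 1) ∧
      x (i + 1) ≠ x i ∧ x (i + 2) ≠ x i ∧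
      (∃! z : ℝ × ℝ, (∃ t : ℝ, z = x i + t • (x (i + 1) - x i)) ∧
        z.1 ^ 2 / a₁ ^ 2 + z.2 ^ 2 / a₂ ^ 2 = 1))
    (hex : ∃ x : ℕ → ℝ × ℝ, Admissible x ∧ x n = x 0 ∧ x (n + 1) = x 1) :
    ∀ y : ℕ → ℝ × ℝ, Admissible y → y n = y 0 := by
  intro y hy
  obtain ⟨x, hx, hxn, -⟩ := hex
  have ha₁ : 0 < a₁ := ha₂.trans ha
  have hA : 0 < √(a₁ ^ 2 + lam) := sqrt_pos.2 (by positivity)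
  have hB : 0 < √(a₂ ^ 2 + lam) := sqrt_pos.2 (by positivity)
  have hA2 : √(a₁ ^ 2 + lam) ^ 2 = a₁ ^ 2 + lam := sq_sqrt (by positivity)
  have hB2 : √(a₂ ^ 2 + lam) ^ 2 = a₂ ^ 2 + lam := sq_sqrt (by positivity)
  have hu : 0 < a₁ ^ 2 / (a₁ ^ 2 + lam) := by positivity
  have hv : 0 < a₂ ^ 2 / (a₂ ^ 2 + lam) := by positivity
  obtain ⟨F, P, c, hmono, hper, hF⟩ := exists_poncelet_coordinate hu
    ((div_lt_one (by positivity)).2 (by linarith)) hv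
    ((div_lt_one (by positivity)).2 (by linarith))
  have lift : ∀ w : ℕ → ℝ × ℝ, Admissible w → ∃ (θ : ℕ → ℝ) (r : ℝ), (r = c ∨ r = -c) ∧
      (∀ i, w i = (√(a₁ ^ 2 + lam) * cos (θ i), √(a₂ ^ 2 + lam) * sin (θ i))) ∧
      ∀ i : ℕ, F (θ i) = F (θ 0) + i * r := by
    intro w hw
    rw [hAdm] at hw
    refine exists_angles_of_trajectory hu hv hA hB hmono.injective hF
      (fun i => by rw [hA2, hB2]; exact (hw i).1) (fun i => (hw i).2.1) (fun i => (hw i).2.2.1)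
      fun i => ?_
    rw [hA2, hB2, div_mul_cancel₀ _ (by positivity), div_mul_cancel₀ _ (by positivity)]
    exact discrim_eq_of_existsUnique_inter (by positivity) (by positivity) (hw i).2.1 (hw i).2.2.2
  have hshift : ∀ (k : ℤ) (t : ℝ), F (t + k * (2 * π)) = F t + k * P := by
    intro k
    induction k with
    | zero => simp
    | succ k ih =>
      intro t
      have := hper (t + k * (2 * π))
      rw [show t + ((k + 1 : ℤ) : ℝ) * (2 * π) = t + k * (2 * π) + 2 * π by push_cast; ring, this]
      have := ih t
      push_cast at this ⊢
      linarith
    | pred k ih =>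
      intro t
      have := hper (t + ((-k - 1 : ℤ) : ℝ) * (2 * π))
      have h2 := ih t
      rw [show t + ((-k - 1 : ℤ) : ℝ) * (2 * π) + 2 * π = t + ((-k : ℤ) : ℝ) * (2 * π) by
        push_cast; ring] at this
      push_cast at this h2 ⊢
      linarith
  obtain ⟨θ, r, hr, hθ, hFθ⟩ := lift x hx
  obtain ⟨φ, r', hr', hφ, hFφ⟩ := lift y hy
  obtain ⟨k, hk⟩ : ∃ k : ℤ, θ n = θ 0 + k * (2 * π) := by
    rw [hθ, hθ 0, Prod.mk.injEq, mul_right_inj' hA.ne', mul_right_inj' hB.ne'] at hxn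
    obtain ⟨k, hk⟩ := Real.Angle.angle_eq_iff_two_pi_dvd_sub.1
      (Real.Angle.cos_sin_inj hxn.1 hxn.2)
    exact ⟨k, by linarith⟩
  have hnr : n * r = k * P := by
    have h1 := hFθ n
    rw [hk, hshift] at h1
    linarith
  obtain ⟨l, hl⟩ : ∃ l : ℤ, n * r' = l * P := by
    have hrr : r' = r ∨ r' = -r := by
      rcases hr with rfl | rfl <;> rcases hr' with rfl | rfl <;> simp
    rcases hrr with rfl | rfl
    · exact ⟨k, hnr⟩
    · exact ⟨-k, by push_cast; linarith⟩
  have hφn : φ n = φ 0 + l * (2 * π) := by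
    apply hmono.injective
    rw [hshift, hFφ n, hl]
  rw [hφ, hφ 0, hφn, cos_add_int_mul_two_pi, sin_add_int_mul_two_pi]
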